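/- Let (X,ω) be a hermitian complex threefold whose metric is conformally balanced, d(e^{−2Φ̂} ω²) = 0, for a smooth function Φ̂, and let T = i(∂−∂̄)ω. Then ⋆T = −e^{2Φ̂} d(e^{−2Φ̂} ω) and d ⋆ (e^{−2Φ̂} T) = 0, where ⋆ is the Hodge star operator of ω. -/

import Mathlib

noncomputable section

/-!
# Statement 13

Let `(X,ω)` be a hermitian complex threefold whose metric is conformally balanced,
`d(e^{−2Φ̂} ω²) = 0`, for a smooth function `Φ̂`, and let `T = i(∂−∂̄)ω`.  Then
`⋆T = −e^{2Φ̂} d(e^{−2Φ̂} ω)` and `d ⋆ (e^{−2Φ̂} T) = 0`, where `⋆` is the Hodge star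
operator of `ω` (with volume form `ω³/3!`).

Formalised on the local model `ℂ³`.
-/
open scoped BigOperators

/-! ## The local model

`Pt = ℂ³` with its standard holomorphic coordinates is the local model of a complex
threefold.  Tensors are given by their components in the complexified coordinate frame:
the index type is `Ix = Fin 3 ⊕ Fin 3`, where `Sum.inl μ` is the holomorphic index `μ`
and `Sum.inr μ` is the antiholomorphic index `μ̄`.  A hermitian metric
`ω = i g_{μν̄} dz^μ ∧ dz̄^ν` is encoded by its components `g μ ν = g_{μν̄}` together with
the components `ginv α β = g^{αβ̄}` of the inverse metric.  Components of a `p`-form `Q`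
follow the normalization `Q = (1/p!) Q_{m₁⋯m_p} dx^{m₁} ∧ ⋯ ∧ dx^{m_p}`.
-/

/-- The local model of a complex threefold: `ℂ³`. -/
abbrev Pt : Type := EuclideanSpace ℂ (Fin 3)

/-- The holomorphic Wirtinger derivative `∂/∂z^μ`. -/
def Dh (μ : Fin 3) (f : Pt → ℂ) : Pt → ℂ := fun z =>
  (2⁻¹ : ℂ) * (fderiv ℝ f z (EuclideanSpace.single μ 1)
    - Complex.I * fderiv ℝ f z (EuclideanSpace.single μ Complex.I))

/-- The antiholomorphic Wirtinger derivative `∂/∂z̄^μ`. -/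
def Da (μ : Fin 3) (f : Pt → ℂ) : Pt → ℂ := fun z =>
  (2⁻¹ : ℂ) * (fderiv ℝ f z (EuclideanSpace.single μ 1)
    + Complex.I * fderiv ℝ f z (EuclideanSpace.single μ Complex.I))

/-- Complexified coordinate index: `inl μ ↦ z^μ`, `inr μ ↦ z̄^μ`. -/
abbrev Ix : Type := Fin 3 ⊕ Fin 3

/-- The partial derivative in the direction of a complexified index. -/
def DF : Ix → (Pt → ℂ) → (Pt → ℂ)
  | Sum.inl μ => Dh μ
  | Sum.inr μ => Da μ

/-- Number of holomorphic indices (`1` for `inl`, `0` for `inr`). -/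
def nHol : Ix → ℕ
  | Sum.inl _ => 1
  | Sum.inr _ => 0

/-- Full components of the hermitian metric: `gF_{μν̄} = g_{μν̄}`, `gF_{ν̄μ} = g_{μν̄}`,
and the pure components vanish. -/
def gF (g : Fin 3 → Fin 3 → Pt → ℂ) : Ix → Ix → Pt → ℂ
  | Sum.inl μ, Sum.inr ν => g μ ν
  | Sum.inr ν, Sum.inl μ => g μ ν
  | _, _ => 0

/-- Full components of the inverse metric. -/
def ginvF (ginv : Fin 3 → Fin 3 → Pt → ℂ) : Ix → Ix → Pt → ℂ
  | Sum.inl α, Sum.inr β => ginv α β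
  | Sum.inr β, Sum.inl α => ginv α β
  | _, _ => 0

/-- Full components of the hermitian form `ω = i g_{μν̄} dz^μ ∧ dz̄^ν`. -/
def omF (g : Fin 3 → Fin 3 → Pt → ℂ) : Ix → Ix → Pt → ℂ
  | Sum.inl μ, Sum.inr ν => fun z => Complex.I * g μ ν z
  | Sum.inr ν, Sum.inl μ => fun z => -(Complex.I * g μ ν z)
  | _, _ => 0

/-- Exterior derivative of a 2-form, in components. -/
def dTwo (η : Ix → Ix → Pt → ℂ) (a b c : Ix) : Pt → ℂ := fun z =>
  DF a (η b c) z - DF b (η a c) z + DF c (η a b) z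

/-- Exterior derivative of a 3-form, in components. -/
def dThree (η : Ix → Ix → Ix → Pt → ℂ) (a b c d : Ix) : Pt → ℂ := fun z =>
  DF a (η b c d) z - DF b (η a c d) z + DF c (η a b d) z - DF d (η a b c) z

/-- Exterior derivative of a 4-form, in components. -/
def dFour (η : Ix → Ix → Ix → Ix → Pt → ℂ) (a b c d e : Ix) : Pt → ℂ := fun z =>
  DF a (η b c d e) z - DF b (η a c d e) z + DF c (η a b d e) z
    - DF d (η a b c e) z + DF e (η a b c d) z

/-- The torsion 3-form `T = i(∂ − ∂̄)ω`:  on a complex manifold, the `(2,1)`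
(resp. `(1,2)`) part of `dω` is obtained by restricting to index patterns with exactly
two (resp. one) holomorphic indices.  In particular
`T_{μνρ̄} = −∂_μ g_{νρ̄} + ∂_ν g_{μρ̄}`. -/
def TorF (g : Fin 3 → Fin 3 → Pt → ℂ) (a b c : Ix) : Pt → ℂ := fun z =>
  Complex.I * ((if nHol a + nHol b + nHol c = 2 then (1:ℂ) else 0)
    - (if nHol a + nHol b + nHol c = 1 then (1:ℂ) else 0)) * dTwo (omF g) a b c z

/-- The `(1,2)` part `∂̄ω` of `dω`. -/
def pbarOm (g : Fin 3 → Fin 3 → Pt → ℂ) (a b c : Ix) : Pt → ℂ := fun z =>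
  if nHol a + nHol b + nHol c = 1 then dTwo (omF g) a b c z else 0

/-- The `(2,2)`-form `i ∂∂̄ω`, obtained as `i` times the `(2,2)` part of `d(∂̄ω)`. -/
def iddbarOm (g : Fin 3 → Fin 3 → Pt → ℂ) (a b c d : Ix) : Pt → ℂ := fun z =>
  Complex.I * (if nHol a + nHol b + nHol c + nHol d = 2
    then dThree (pbarOm g) a b c d z else 0)

/-- The trace `T_μ{}^μ{}_m = g^{μν̄} T_{μν̄m}` of the torsion. -/
def TrT (g ginv : Fin 3 → Fin 3 → Pt → ℂ) (m : Ix) : Pt → ℂ := fun z =>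
  ∑ μ, ∑ ν, ginv μ ν z * TorF g (Sum.inl μ) (Sum.inr ν) m z

/-- The contraction operator `(iΛ_ω η)_K = g^{μν̄} η_{μν̄K}` on 3-forms. -/
def iLam3 (ginv : Fin 3 → Fin 3 → Pt → ℂ) (η : Ix → Ix → Ix → Pt → ℂ) (k : Ix) :
    Pt → ℂ := fun z =>
  ∑ μ, ∑ ν, ginv μ ν z * η (Sum.inl μ) (Sum.inr ν) k z

/-- The operator `Λ_ω = −i ⋅ (iΛ_ω)` on 3-forms. -/
def Lam3 (ginv : Fin 3 → Fin 3 → Pt → ℂ) (η : Ix → Ix → Ix → Pt → ℂ) (k : Ix) :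
    Pt → ℂ := fun z =>
  -Complex.I * iLam3 ginv η k z

/-- The sign of a permutation, as a complex number. -/
def sgn {n : ℕ} (σ : Equiv.Perm (Fin n)) : ℂ := ((Equiv.Perm.sign σ : ℤ) : ℂ)

/-- Components of the wedge product of a 1-form and a 4-form. -/
def wedge14 (a : Ix → Pt → ℂ) (B : Ix → Ix → Ix → Ix → Pt → ℂ) (v : Fin 5 → Ix) :
    Pt → ℂ := fun z =>
  (24⁻¹ : ℂ) * ∑ σ : Equiv.Perm (Fin 5),
    sgn σ * a (v (σ 0)) z * B (v (σ 1)) (v (σ 2)) (v (σ 3)) (v (σ 4)) z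

/-- Components of the wedge product of three 2-forms. -/
def wedge222 (A B C : Ix → Ix → Pt → ℂ) (v : Fin 6 → Ix) : Pt → ℂ := fun z =>
  (8⁻¹ : ℂ) * ∑ σ : Equiv.Perm (Fin 6),
    sgn σ * A (v (σ 0)) (v (σ 1)) z * B (v (σ 2)) (v (σ 3)) z * C (v (σ 4)) (v (σ 5)) z

/-- The volume form `ω³/3!` of the hermitian metric. -/
def volOm (g : Fin 3 → Fin 3 → Pt → ℂ) (v : Fin 6 → Ix) : Pt → ℂ := fun z =>
  (6⁻¹ : ℂ) * wedge222 (omF g) (omF g) (omF g) v z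

/-- The Hodge star of a 3-form, `(⋆χ)_{mnp} = (1/3!) χ^{qrs} Vol_{qrsmnp}`, with the
volume form `ω³/3!`. -/
def hstar (g ginv : Fin 3 → Fin 3 → Pt → ℂ) (χ : Ix → Ix → Ix → Pt → ℂ)
    (m n p : Ix) : Pt → ℂ := fun z =>
  (6⁻¹ : ℂ) * ∑ q, ∑ r, ∑ s, ∑ q', ∑ r', ∑ s',
    ginvF ginv q q' z * ginvF ginv r r' z * ginvF ginv s s' z * χ q' r' s' z *
      volOm g ![q, r, s, m, n, p] z

/-- Components of the wedge product of two 2-forms. -/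
def wedge22 (A B : Ix → Ix → Pt → ℂ) (a b c d : Ix) : Pt → ℂ := fun z =>
  A a b z * B c d z - A a c z * B b d z + A a d z * B b c z
    + A c d z * B a b z - A b d z * B a c z + A b c z * B a d z

lemma sum_perm_succ {n : ℕ} (f : Equiv.Perm (Fin (n+1)) → ℂ) :
    ∑ σ, f σ = ∑ i, ∑ e : Equiv.Perm (Fin n), f (Equiv.Perm.decomposeFin.symm (i, e)) := by
  rw [← Fintype.sum_prod_type', ← Equiv.sum_comp Equiv.Perm.decomposeFin.symm]

lemma sgn_dec {n : ℕ} (i : Fin (n+1)) (e : Equiv.Perm (Fin n)) :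
    sgn (Equiv.Perm.decomposeFin.symm (i, e)) = (if i = 0 then 1 else -1) * sgn e := by
  unfold sgn
  rw [Equiv.Perm.decomposeFin.symm_sign]
  split_ifs <;> simp

/-- Peeling off the first value of a permutation in an alternating sum. -/
lemma sum_peel {n : ℕ} {ι : Type} (F : ι → (Fin n → ι) → ℂ) (v : Fin (n+1) → ι) :
    ∑ σ : Equiv.Perm (Fin (n+1)), sgn σ * F (v (σ 0)) (fun x => v (σ x.succ)) =
      ∑ i, (if i = 0 then 1 else -1) * ∑ e : Equiv.Perm (Fin n),
        sgn e * F (v i) (fun x => v (Equiv.swap 0 i (e x).succ)) := by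
  rw [sum_perm_succ]
  refine Finset.sum_congr rfl fun i _ => ?_
  rw [Finset.mul_sum]
  refine Finset.sum_congr rfl fun e _ => ?_
  rw [sgn_dec]
  simp only [Equiv.Perm.decomposeFin_symm_apply_zero, Equiv.Perm.decomposeFin_symm_apply_succ]
  ring

lemma pf2 {ι : Type} (A : ι → ι → ℂ) (hA : ∀ a b, A a b = - A b a) (v : Fin 2 → ι) :
    ∑ σ : Equiv.Perm (Fin 2), sgn σ * A (v (σ 0)) (v (σ 1)) = 2 * A (v 0) (v 1) := by
  have := sum_peel (n := 1) (fun a w => A a (w 0)) v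
  simp only [Fin.succ_zero_eq_one] at this
  rw [this]
  simp [Fin.sum_univ_two, sgn]
  rw [hA (v 1) (v 0)]; ring

lemma pf4 {ι : Type} (A : ι → ι → ℂ) (hA : ∀ a b, A a b = - A b a) (v : Fin 4 → ι) :
    ∑ σ : Equiv.Perm (Fin 4), sgn σ * (A (v (σ 0)) (v (σ 1)) * A (v (σ 2)) (v (σ 3))) =
      8 * (A (v 0) (v 1) * A (v 2) (v 3) - A (v 0) (v 2) * A (v 1) (v 3)
        + A (v 0) (v 3) * A (v 1) (v 2)) := by
  have h1 := sum_peel (n := 3) (fun a w => A a (w 0) * A (w 1) (w 2)) v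
  have h2 := fun (a : ι) (u : Fin 3 → ι) =>
    sum_peel (n := 2) (fun b w => A a b * A (w 0) (w 1)) u
  have h3 : ∀ (c : ℂ) (u : Fin 2 → ι), ∑ σ : Equiv.Perm (Fin 2), sgn σ * (c * A (u (σ 0)) (u (σ 1)))
      = c * (2 * A (u 0) (u 1)) := by
    intro c u
    rw [← pf2 A hA, Finset.mul_sum]
    exact Finset.sum_congr rfl fun _ _ => by ring
  simp only [Fin.succ_zero_eq_one, Fin.succ_one_eq_two, show Fin.succ (2 : Fin 3) = 3 from rfl] at h1 h2
  have h2' := fun (a : ι) (i : Fin 4) => h2 a (fun x => v (Equiv.swap 0 i x.succ))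
  have h3' := fun (c : ℂ) (i : Fin 4) (j : Fin 3) =>
    h3 c (fun y => v (Equiv.swap 0 i (Equiv.swap 0 j y.succ).succ))
  beta_reduce at h1 h2' h3'
  rw [h1]
  simp only [h2', h3']
  have s1 : ∀ f : Fin (3 + 1) → ℂ, ∑ i, f i = f 0 + f 1 + f 2 + f 3 := Fin.sum_univ_four
  have s2 : ∀ f : Fin (2 + 1) → ℂ, ∑ i, f i = f 0 + f 1 + f 2 := Fin.sum_univ_three
  simp only [s1, s2]
  simp [Equiv.swap_apply_def, Fin.ext_iff]
  have e10 := hA (v 1) (v 0)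
  have e20 := hA (v 2) (v 0)
  have e30 := hA (v 3) (v 0)
  have e21 := hA (v 2) (v 1)
  have e31 := hA (v 3) (v 1)
  have e32 := hA (v 3) (v 2)
  simp only [e10, e20, e30, e21, e31, e32]
  ring

lemma pf6 {ι : Type} (A : ι → ι → ℂ) (hA : ∀ a b, A a b = - A b a) (v : Fin 6 → ι) :
    ∑ σ : Equiv.Perm (Fin 6), sgn σ * (A (v (σ 0)) (v (σ 1)) * A (v (σ 2)) (v (σ 3))
        * A (v (σ 4)) (v (σ 5))) =
      48 * (A (v 0) (v 1) * (A (v 2) (v 3) * A (v 4) (v 5) - A (v 2) (v 4) * A (v 3) (v 5)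
              + A (v 2) (v 5) * A (v 3) (v 4))
          - A (v 0) (v 2) * (A (v 1) (v 3) * A (v 4) (v 5) - A (v 1) (v 4) * A (v 3) (v 5)
              + A (v 1) (v 5) * A (v 3) (v 4))
          + A (v 0) (v 3) * (A (v 1) (v 2) * A (v 4) (v 5) - A (v 1) (v 4) * A (v 2) (v 5)
              + A (v 1) (v 5) * A (v 2) (v 4))
          - A (v 0) (v 4) * (A (v 1) (v 2) * A (v 3) (v 5) - A (v 1) (v 3) * A (v 2) (v 5)
              + A (v 1) (v 5) * A (v 2) (v 3))
          + A (v 0) (v 5) * (A (v 1) (v 2) * A (v 3) (v 4) - A (v 1) (v 3) * A (v 2) (v 4)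
              + A (v 1) (v 4) * A (v 2) (v 3))) := by
  have h1 := sum_peel (n := 5) (fun a w => A a (w 0) * A (w 1) (w 2) * A (w 3) (w 4)) v
  have h2 := fun (a : ι) (u : Fin 5 → ι) =>
    sum_peel (n := 4) (fun b w => A a b * A (w 0) (w 1) * A (w 2) (w 3)) u
  have h3 : ∀ (c : ℂ) (u : Fin 4 → ι), ∑ σ : Equiv.Perm (Fin 4),
      sgn σ * (c * A (u (σ 0)) (u (σ 1)) * A (u (σ 2)) (u (σ 3)))
      = c * (8 * (A (u 0) (u 1) * A (u 2) (u 3) - A (u 0) (u 2) * A (u 1) (u 3)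
        + A (u 0) (u 3) * A (u 1) (u 2))) := by
    intro c u
    rw [← pf4 A hA, Finset.mul_sum]
    exact Finset.sum_congr rfl fun _ _ => by ring
  simp only [Fin.succ_zero_eq_one, Fin.succ_one_eq_two, show Fin.succ (2 : Fin 5) = 3 from rfl,
    show Fin.succ (3 : Fin 5) = 4 from rfl, show Fin.succ (4 : Fin 5) = 5 from rfl,
    show Fin.succ (2 : Fin 4) = 3 from rfl, show Fin.succ (3 : Fin 4) = 4 from rfl] at h1 h2
  have h2' := fun (a : ι) (i : Fin 6) => h2 a (fun x => v (Equiv.swap 0 i x.succ))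
  have h3' := fun (c : ℂ) (i : Fin 6) (j : Fin 5) =>
    h3 c (fun y => v (Equiv.swap 0 i (Equiv.swap 0 j y.succ).succ))
  beta_reduce at h1 h2' h3'
  rw [h1]
  simp only [h2', h3']
  have s1 : ∀ f : Fin (5 + 1) → ℂ, ∑ i, f i = f 0 + f 1 + f 2 + f 3 + f 4 + f 5 :=
    Fin.sum_univ_six
  have s2 : ∀ f : Fin (4 + 1) → ℂ, ∑ i, f i = f 0 + f 1 + f 2 + f 3 + f 4 := Fin.sum_univ_five
  simp only [s1, s2]
  simp [Equiv.swap_apply_def, Fin.ext_iff]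
  have e10 := hA (v 1) (v 0)
  have e20 := hA (v 2) (v 0)
  have e30 := hA (v 3) (v 0)
  have e40 := hA (v 4) (v 0)
  have e50 := hA (v 5) (v 0)
  have e21 := hA (v 2) (v 1)
  have e31 := hA (v 3) (v 1)
  have e41 := hA (v 4) (v 1)
  have e51 := hA (v 5) (v 1)
  have e32 := hA (v 3) (v 2)
  have e42 := hA (v 4) (v 2)
  have e52 := hA (v 5) (v 2)
  have e43 := hA (v 4) (v 3)
  have e53 := hA (v 5) (v 3)
  have e54 := hA (v 5) (v 4)
  simp only [e10, e20, e30, e40, e50, e21, e31, e41, e51, e32, e42, e52, e43, e53, e54]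
  ring

lemma sum_shuffle {ι : Type} [Fintype ι] (h : ι → ι → ι → ι → ι → ι → ℂ) :
    ∑ q, ∑ r, ∑ s, ∑ q', ∑ r', ∑ s', h q r s q' r' s' =
    ∑ q, ∑ q', ∑ r, ∑ r', ∑ s, ∑ s', h q r s q' r' s' := by
  refine Finset.sum_congr rfl fun q _ => ?_
  calc _ = ∑ r, ∑ q', ∑ s, ∑ r', ∑ s', h q r s q' r' s' :=
        Finset.sum_congr rfl fun r _ => Finset.sum_comm
    _ = ∑ q', ∑ r, ∑ s, ∑ r', ∑ s', h q r s q' r' s' := Finset.sum_comm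
    _ = _ := Finset.sum_congr rfl fun q' _ => Finset.sum_congr rfl fun r _ => Finset.sum_comm

section Contraction

variable {ι : Type} [Fintype ι] [DecidableEq ι] {G ω : ι → ι → ℂ} {j : ι → ℂ}

lemma contrJ (hJ : ∀ a m, ∑ q, G q a * ω q m = if a = m then j m else 0)
    (F : ι → ℂ) (m : ι) :
    ∑ q, ∑ q', G q q' * (F q' * ω q m) = j m * F m := by
  rw [Finset.sum_comm]
  have : ∀ q', ∑ q, G q q' * (F q' * ω q m) = F q' * (if q' = m then j m else 0) := by
    intro q'
    rw [← hJ, Finset.mul_sum]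
    exact Finset.sum_congr rfl fun _ _ => by ring
  simp only [this]
  simp [mul_comm]

lemma contrJJJ (hJ : ∀ a m, ∑ q, G q a * ω q m = if a = m then j m else 0)
    (χ : ι → ι → ι → ℂ) (m n p : ι) :
    ∑ q, ∑ q', ∑ r, ∑ r', ∑ s, ∑ s', G q q' * G r r' * G s s' * χ q' r' s' *
      (ω q m * ω r n * ω s p) = j m * j n * j p * χ m n p := by
  have e : ∀ q q', ∑ r, ∑ r', ∑ s, ∑ s', G q q' * G r r' * G s s' * χ q' r' s' *
      (ω q m * ω r n * ω s p) = G q q' * ((j n * (j p * χ q' n p)) * ω q m) := by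
    intro q q'
    rw [← contrJ hJ (fun r' => j p * χ q' r' p) n, Finset.sum_mul, Finset.mul_sum]
    refine Finset.sum_congr rfl fun r _ => ?_
    rw [Finset.sum_mul, Finset.mul_sum]
    refine Finset.sum_congr rfl fun r' _ => ?_
    rw [← contrJ hJ (fun s' => χ q' r' s') p]
    simp only [Finset.sum_mul, Finset.mul_sum]
    exact Finset.sum_congr rfl fun s _ => Finset.sum_congr rfl fun s' _ => by ring
  simp only [e]
  rw [contrJ hJ (fun q' => j n * (j p * χ q' n p))]
  ring

/-- contraction of the first two slots against each other -/
lemma contrW (hJ : ∀ a m, ∑ q, G q a * ω q m = if a = m then j m else 0)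
    (F : ι → ι → ℂ) :
    ∑ q, ∑ q', ∑ r, ∑ r', G q q' * G r r' * F q' r' * ω q r =
      ∑ r, ∑ r', j r * G r r' * F r r' := by
  have : ∀ r r', ∑ q, ∑ q', G q q' * G r r' * F q' r' * ω q r = j r * G r r' * F r r' := by
    intro r r'
    have := contrJ hJ (fun q' => F q' r') r
    rw [mul_comm (j r), mul_assoc, ← this]
    simp only [Finset.mul_sum]
    exact Finset.sum_congr rfl fun s _ => Finset.sum_congr rfl fun s' _ => by ring
  simp only [← this]
  calc _ = ∑ q, ∑ r, ∑ q', ∑ r', G q q' * G r r' * F q' r' * ω q r :=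
        Finset.sum_congr rfl fun q _ => Finset.sum_comm
    _ = ∑ r, ∑ q, ∑ q', ∑ r', G q q' * G r r' * F q' r' * ω q r := Finset.sum_comm
    _ = ∑ r, ∑ q, ∑ r', ∑ q', G q q' * G r r' * F q' r' * ω q r :=
        Finset.sum_congr rfl fun r _ => Finset.sum_congr rfl fun q _ => Finset.sum_comm
    _ = _ := Finset.sum_congr rfl fun r _ => Finset.sum_comm

lemma contrWJ (hJ : ∀ a m, ∑ q, G q a * ω q m = if a = m then j m else 0)
    (χ : ι → ι → ι → ℂ) (m n p : ι) :
    ∑ q, ∑ q', ∑ r, ∑ r', ∑ s, ∑ s', G q q' * G r r' * G s s' * χ q' r' s' *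
      (ω q r * ω s m * ω n p) =
      j m * (∑ a, ∑ b, j a * G a b * χ a b m) * ω n p := by
  have e : ∀ q q' r r', ∑ s, ∑ s', G q q' * G r r' * G s s' * χ q' r' s' *
      (ω q r * ω s m * ω n p) = G q q' * G r r' * (j m * χ q' r' m * ω n p) * ω q r := by
    intro q q' r r'
    rw [← contrJ hJ (fun s' => χ q' r' s') m]
    simp only [Finset.sum_mul, Finset.mul_sum]
    exact Finset.sum_congr rfl fun s _ => Finset.sum_congr rfl fun s' _ => by ring
  simp only [e]
  rw [contrW hJ (fun a b => j m * χ a b m * ω n p)]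
  simp only [Finset.sum_mul, Finset.mul_sum]
  exact Finset.sum_congr rfl fun s _ => Finset.sum_congr rfl fun s' _ => by ring

/-- same with the slots one and three contracted -/
lemma contrWJ' (hJ : ∀ a m, ∑ q, G q a * ω q m = if a = m then j m else 0)
    (χ : ι → ι → ι → ℂ) (h23 : ∀ a b c, χ a b c = - χ a c b) (m n p : ι) :
    ∑ q, ∑ q', ∑ r, ∑ r', ∑ s, ∑ s', G q q' * G r r' * G s s' * χ q' r' s' *
      (ω q s * ω r m * ω n p) =
      - (j m * (∑ a, ∑ b, j a * G a b * χ a b m) * ω n p) := by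
  rw [← contrWJ hJ]
  simp only [← Finset.sum_neg_distrib]
  refine Finset.sum_congr rfl fun q _ => Finset.sum_congr rfl fun q' _ => ?_
  calc _ = ∑ r, ∑ s, ∑ r', ∑ s', G q q' * G r r' * G s s' * χ q' r' s' *
      (ω q s * ω r m * ω n p) := Finset.sum_congr rfl fun r _ => Finset.sum_comm
    _ = ∑ s, ∑ r, ∑ r', ∑ s', G q q' * G r r' * G s s' * χ q' r' s' *
      (ω q s * ω r m * ω n p) := Finset.sum_comm
    _ = ∑ s, ∑ r, ∑ s', ∑ r', G q q' * G r r' * G s s' * χ q' r' s' *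
      (ω q s * ω r m * ω n p) :=
        Finset.sum_congr rfl fun r _ => Finset.sum_congr rfl fun q _ => Finset.sum_comm
    _ = ∑ s, ∑ s', ∑ r, ∑ r', G q q' * G r r' * G s s' * χ q' r' s' *
      (ω q s * ω r m * ω n p) := Finset.sum_congr rfl fun r _ => Finset.sum_comm
    _ = _ := by
      refine Finset.sum_congr rfl fun s _ => Finset.sum_congr rfl fun s' _ =>
        Finset.sum_congr rfl fun r _ => Finset.sum_congr rfl fun r' _ => ?_
      rw [h23]; ring

/-- same with the slots two and three contracted -/
lemma contrWJ'' (hJ : ∀ a m, ∑ q, G q a * ω q m = if a = m then j m else 0)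
    (χ : ι → ι → ι → ℂ) (h12 : ∀ a b c, χ a b c = - χ b a c)
    (h23 : ∀ a b c, χ a b c = - χ a c b) (m n p : ι) :
    ∑ q, ∑ q', ∑ r, ∑ r', ∑ s, ∑ s', G q q' * G r r' * G s s' * χ q' r' s' *
      (ω r s * ω q m * ω n p) =
      j m * (∑ a, ∑ b, j a * G a b * χ a b m) * ω n p := by
  have e : ∀ q q', ∑ r, ∑ r', ∑ s, ∑ s', G q q' * G r r' * G s s' * χ q' r' s' *
      (ω r s * ω q m * ω n p) =
      G q q' * ((∑ a, ∑ b, j a * G a b * χ q' a b) * ω n p * ω q m) := by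
    intro q q'
    rw [← contrW hJ (fun a b => χ q' a b)]
    simp only [Finset.sum_mul, Finset.mul_sum]
    exact Finset.sum_congr rfl fun s _ => Finset.sum_congr rfl fun s' _ =>
      Finset.sum_congr rfl fun r _ => Finset.sum_congr rfl fun r' _ => by ring
  simp only [e]
  rw [contrJ hJ (fun q' => (∑ a, ∑ b, j a * G a b * χ q' a b) * ω n p)]
  have : ∀ a b, χ m a b = χ a b m := fun a b => by rw [h12, h23, neg_neg]
  simp only [this]
  ring

/-- The Hodge star in closed form. -/
lemma star_formula (hJ : ∀ a m, ∑ q, G q a * ω q m = if a = m then j m else 0)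
    (χ : ι → ι → ι → ℂ) (h12 : ∀ a b c, χ a b c = - χ b a c)
    (h23 : ∀ a b c, χ a b c = - χ a c b) (m n p : ι) :
    ∑ q, ∑ r, ∑ s, ∑ q', ∑ r', ∑ s', G q q' * G r r' * G s s' * χ q' r' s' *
      (ω q r * (ω s m * ω n p - ω s n * ω m p + ω s p * ω m n)
        - ω q s * (ω r m * ω n p - ω r n * ω m p + ω r p * ω m n)
        + ω q m * (ω r s * ω n p - ω r n * ω s p + ω r p * ω s n)
        - ω q n * (ω r s * ω m p - ω r m * ω s p + ω r p * ω s m)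
        + ω q p * (ω r s * ω m n - ω r m * ω s n + ω r n * ω s m)) =
      - 6 * (j m * j n * j p * χ m n p)
      + 3 * (j m * (∑ a, ∑ b, j a * G a b * χ a b m) * ω n p
        - j n * (∑ a, ∑ b, j a * G a b * χ a b n) * ω m p
        + j p * (∑ a, ∑ b, j a * G a b * χ a b p) * ω m n) := by
  rw [sum_shuffle]
  have c1 := contrWJ hJ χ m n p
  have c2 := contrWJ hJ χ n m p
  have c3 := contrWJ hJ χ p m n
  have d1 := contrWJ' hJ χ h23 m n p
  have d2 := contrWJ' hJ χ h23 n m p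
  have d3 := contrWJ' hJ χ h23 p m n
  have e1 := contrWJ'' hJ χ h12 h23 m n p
  have e2 := contrWJ'' hJ χ h12 h23 n m p
  have e3 := contrWJ'' hJ χ h12 h23 p m n
  have f1 := contrJJJ hJ χ m n p
  have f2 := contrJJJ hJ χ m p n
  have f3 := contrJJJ hJ χ n m p
  have f4 := contrJJJ hJ χ n p m
  have f5 := contrJJJ hJ χ p m n
  have f6 := contrJJJ hJ χ p n m
  have x2 : χ m p n = - χ m n p := h23 _ _ _
  have x3 : χ n m p = - χ m n p := h12 _ _ _
  have x4 : χ n p m = χ m n p := by rw [h23, x3, neg_neg]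
  have x5 : χ p m n = χ m n p := by rw [h12, x2, neg_neg]
  have x6 : χ p n m = - χ m n p := by rw [h23, x5]
  rw [x2] at f2; rw [x3] at f3; rw [x4] at f4; rw [x5] at f5; rw [x6] at f6
  set t1 := ∑ a, ∑ b, j a * G a b * χ a b m
  set t2 := ∑ a, ∑ b, j a * G a b * χ a b n
  set t3 := ∑ a, ∑ b, j a * G a b * χ a b p
  have key : - 6 * (j m * j n * j p * χ m n p)
      + 3 * (j m * t1 * ω n p - j n * t2 * ω m p + j p * t3 * ω m n) =
      (j m * t1 * ω n p) - (j n * t2 * ω m p) + (j p * t3 * ω m n)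
      - (-(j m * t1 * ω n p)) + (-(j n * t2 * ω m p)) - (-(j p * t3 * ω m n))
      + (j m * t1 * ω n p) - (j n * t2 * ω m p) + (j p * t3 * ω m n)
      - j m * j n * j p * χ m n p + j m * j p * j n * -χ m n p
      + j n * j m * j p * -χ m n p - j n * j p * j m * χ m n p
      - j p * j m * j n * χ m n p + j p * j n * j m * -χ m n p := by ring
  rw [key, ← f1, ← f2, ← f3, ← f4, ← f5, ← f6, ← d1, ← d2, ← d3]
  nth_rewrite 1 [← c1]
  nth_rewrite 1 [← c2]
  nth_rewrite 1 [← c3]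
  rw [← e1, ← e2, ← e3]
  simp (config := { maxSteps := 2000000 }) only [← Finset.sum_add_distrib, ← Finset.sum_sub_distrib]
  refine Finset.sum_congr rfl fun q _ => Finset.sum_congr rfl fun q' _ =>
    Finset.sum_congr rfl fun r _ => Finset.sum_congr rfl fun r' _ =>
    Finset.sum_congr rfl fun s _ => Finset.sum_congr rfl fun s' _ => ?_
  ring

end Contraction

section Trace

variable {ι : Type} [Fintype ι] [DecidableEq ι] {W ω : ι → ι → ℂ}

lemma trA (hWω : ∀ b c, ∑ a, W a b * ω a c = if b = c then 1 else 0) (F : ι → ℂ) (c : ι) :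
    ∑ a, ∑ b, W a b * (ω a c * F b) = F c := by
  rw [Finset.sum_comm]
  have : ∀ b, ∑ a, W a b * (ω a c * F b) = F b * (if b = c then 1 else 0) := by
    intro b
    rw [← hWω, Finset.mul_sum]
    exact Finset.sum_congr rfl fun _ _ => by ring
  simp only [this]
  simp

lemma trB (hW : ∀ a b, W a b = - W b a)
    (hWω : ∀ b c, ∑ a, W a b * ω a c = if b = c then 1 else 0) (F : ι → ℂ) (c : ι) :
    ∑ a, ∑ b, W a b * (ω b c * F a) = - F c := by
  rw [Finset.sum_comm, ← trA hWω F c, ← Finset.sum_neg_distrib]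
  refine Finset.sum_congr rfl fun a _ => ?_
  rw [← Finset.sum_neg_distrib]
  refine Finset.sum_congr rfl fun b _ => ?_
  rw [hW]; ring

lemma trC (hWω : ∀ b c, ∑ a, W a b * ω a c = if b = c then 1 else 0) (F : ℂ) :
    ∑ a, ∑ b, W a b * (ω a b * F) = Fintype.card ι * F := by
  rw [Finset.sum_comm]
  have : ∀ b, ∑ a, W a b * (ω a b * F) = F := by
    intro b
    have := hWω b b
    rw [if_pos rfl] at this
    calc _ = (∑ a, W a b * ω a b) * F := by
          rw [Finset.sum_mul]; exact Finset.sum_congr rfl fun _ _ => by ring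
      _ = F := by rw [this, one_mul]
  simp [this]

lemma trD (F : ι → ι → ℂ) (c : ℂ) :
    ∑ a, ∑ b, W a b * (c * F a b) = c * ∑ a, ∑ b, W a b * F a b := by
  simp only [Finset.mul_sum]
  exact Finset.sum_congr rfl fun _ _ => Finset.sum_congr rfl fun _ _ => by ring

/-- trace of `ω ∧ θ` for a 1-form `θ`. -/
lemma tr_wedge (h6 : Fintype.card ι = 6) (hW : ∀ a b, W a b = - W b a)
    (hWω : ∀ b c, ∑ a, W a b * ω a c = if b = c then 1 else 0) (θ : ι → ℂ) (e : ι) :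
    ∑ a, ∑ b, W a b * (θ a * ω b e - θ b * ω a e + θ e * ω a b) = 4 * θ e := by
  have h1 := trA hWω θ e
  have h2 := trB hW hWω θ e
  have h3 := trC hWω (θ e)
  rw [h6] at h3
  have : 4 * θ e = -θ e - θ e + (6 : ℕ) * θ e := by push_cast; ring
  rw [this, ← h3]
  nth_rewrite 1 [← h2]
  nth_rewrite 2 [← h1]
  simp only [← Finset.sum_add_distrib, ← Finset.sum_sub_distrib]
  exact Finset.sum_congr rfl fun _ _ => Finset.sum_congr rfl fun _ _ => by ring

/-- If `ω ∧ Q = 0` for a 3-form `Q` in real dimension six then the trace of `Q` vanishes. -/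
lemma tr_zero (h6 : Fintype.card ι = 6) (hW : ∀ a b, W a b = - W b a)
    (hWω : ∀ b c, ∑ a, W a b * ω a c = if b = c then 1 else 0)
    (Q : ι → ι → ι → ℂ) (h12 : ∀ a b c, Q a b c = - Q b a c)
    (h23 : ∀ a b c, Q a b c = - Q a c b)
    (hQ : ∀ a b c d e, ω a b * Q c d e - ω a c * Q b d e + ω a d * Q b c e - ω a e * Q b c d
      + ω b c * Q a d e - ω b d * Q a c e + ω b e * Q a c d
      + ω c d * Q a b e - ω c e * Q a b d + ω d e * Q a b c = 0) (e : ι) :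
    ∑ a, ∑ b, W a b * Q a b e = 0 := by
  set t : ι → ℂ := fun e => ∑ a, ∑ b, W a b * Q a b e with ht
  have s1 : ∀ c d e, ω c d * t e - ω c e * t d + ω d e * t c = 0 := by
    intro c d e
    have a1 := trC hWω (Q c d e)
    have a2 := trA hWω (fun b => Q b d e) c
    have a3 := trA hWω (fun b => Q b c e) d
    have a4 := trA hWω (fun b => Q b c d) e
    have b2 := trB hW hWω (fun b => Q b d e) c
    have b3 := trB hW hWω (fun b => Q b c e) d
    have b4 := trB hW hWω (fun b => Q b c d) e
    have c1 := trD (W := W) (fun a b => Q a b e) (ω c d)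
    have c2 := trD (W := W) (fun a b => Q a b d) (ω c e)
    have c3 := trD (W := W) (fun a b => Q a b c) (ω d e)
    rw [h6] at a1
    have x3 : Q d c e = - Q c d e := h12 _ _ _
    have x4 : Q e c d = Q c d e := by rw [h12, h23, neg_neg]
    simp only [x3] at a3 b3
    simp only [x4] at a4 b4
    have z : ∑ a, ∑ b, W a b * (ω a b * Q c d e - ω a c * Q b d e + ω a d * Q b c e - ω a e * Q b c d
      + ω b c * Q a d e - ω b d * Q a c e + ω b e * Q a c d
      + ω c d * Q a b e - ω c e * Q a b d + ω d e * Q a b c) = 0 := by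
      simp [hQ]
    simp only [mul_add, mul_sub, Finset.sum_add_distrib, Finset.sum_sub_distrib] at z
    rw [a1, a2, a3, a4, b2, b3, b4, c1, c2, c3] at z
    rw [← z]
    push_cast
    ring
  have s2 := tr_wedge h6 hW hWω t e
  have : ∀ a b, t a * ω b e - t b * ω a e + t e * ω a b = 0 := by
    intro a b
    rw [← s1 a b e]; ring
  simp only [this] at s2
  simp at s2
  exact s2

end Trace

/-! ### The coordinate derivations -/

def dirOne : Ix → Pt
  | Sum.inl μ => EuclideanSpace.single μ 1
  | Sum.inr μ => EuclideanSpace.single μ 1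

def dirI : Ix → Pt
  | Sum.inl μ => EuclideanSpace.single μ Complex.I
  | Sum.inr μ => EuclideanSpace.single μ Complex.I

/-- The eigenvalue of the complex structure (up to sign) on an index. -/
def jj : Ix → ℂ
  | Sum.inl _ => -Complex.I
  | Sum.inr _ => Complex.I

lemma DF_eq (a : Ix) (f : Pt → ℂ) (z : Pt) :
    DF a f z = 2⁻¹ * (fderiv ℝ f z (dirOne a) + jj a * fderiv ℝ f z (dirI a)) := by
  rcases a with a | a
  · simp only [DF, Dh, dirOne, dirI, jj]; ring
  · simp only [DF, Da, dirOne, dirI, jj]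

lemma DF_zero (a : Ix) (z : Pt) : DF a 0 z = 0 := by
  rw [DF_eq]; simp

lemma DF_neg (a : Ix) (f : Pt → ℂ) (z : Pt) : DF a (-f) z = - DF a f z := by
  rw [DF_eq, DF_eq, fderiv_neg]; simp; ring

lemma DF_add (a : Ix) {f h : Pt → ℂ} {z : Pt} (hf : DifferentiableAt ℝ f z)
    (hh : DifferentiableAt ℝ h z) :
    DF a (fun w => f w + h w) z = DF a f z + DF a h z := by
  rw [DF_eq, DF_eq, DF_eq, fderiv_fun_add hf hh]; simp; ring

lemma DF_sub (a : Ix) {f h : Pt → ℂ} {z : Pt} (hf : DifferentiableAt ℝ f z)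
    (hh : DifferentiableAt ℝ h z) :
    DF a (fun w => f w - h w) z = DF a f z - DF a h z := by
  rw [DF_eq, DF_eq, DF_eq, fderiv_fun_sub hf hh]; simp; ring

lemma DF_mul (a : Ix) {f h : Pt → ℂ} {z : Pt} (hf : DifferentiableAt ℝ f z)
    (hh : DifferentiableAt ℝ h z) :
    DF a (fun w => f w * h w) z = DF a f z * h z + f z * DF a h z := by
  rw [DF_eq, DF_eq, DF_eq, fderiv_fun_mul hf hh]; simp; ring

lemma DF_contDiff (a : Ix) {f : Pt → ℂ} (hf : ContDiff ℝ (⊤ : ℕ∞) f) :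
    ContDiff ℝ (⊤ : ℕ∞) (DF a f) := by
  have h1 : ∀ v : Pt, ContDiff ℝ (⊤ : ℕ∞) (fun z => fderiv ℝ f z v) := fun v =>
    (hf.fderiv_right (m := (⊤ : ℕ∞)) (by simp)).clm_apply contDiff_const
  have : DF a f = fun z => 2⁻¹ * (fderiv ℝ f z (dirOne a) + jj a * fderiv ℝ f z (dirI a)) :=
    funext fun z => DF_eq a f z
  rw [this]
  exact contDiff_const.mul ((h1 _).add (contDiff_const.mul (h1 _)))

lemma sndDeriv_symm {f : Pt → ℂ} (hf : ContDiff ℝ (⊤ : ℕ∞) f) (z v w : Pt) :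
    fderiv ℝ (fun y => fderiv ℝ f y v) z w = fderiv ℝ (fun y => fderiv ℝ f y w) z v := by
  have hd : DifferentiableAt ℝ (fderiv ℝ f) z :=
    ((hf.fderiv_right (m := (⊤ : ℕ∞)) (by simp)).differentiable (by simp)) z
  have h2 : IsSymmSndFDerivAt ℝ f z :=
    (hf.contDiffAt (x := z)).isSymmSndFDerivAt
      (by simp only [minSmoothness_of_isRCLikeNormedField]; exact WithTop.coe_le_coe.2 le_top)
  rw [fderiv_clm_apply hd (differentiableAt_const v), fderiv_clm_apply hd (differentiableAt_const w)]
  simpa using h2.eq w v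

lemma DF_comm (a b : Ix) {f : Pt → ℂ} (hf : ContDiff ℝ (⊤ : ℕ∞) f) (z : Pt) :
    DF a (DF b f) z = DF b (DF a f) z := by
  have hd : ∀ v : Pt, DifferentiableAt ℝ (fun z => fderiv ℝ f z v) z := fun v =>
    ((hf.fderiv_right (m := (⊤ : ℕ∞)) (by simp)).clm_apply contDiff_const).differentiable
      (by simp) z
  have key : ∀ a b : Ix, DF a (DF b f) z = 4⁻¹ *
      (fderiv ℝ (fun y => fderiv ℝ f y (dirOne b)) z (dirOne a)
       + jj b * fderiv ℝ (fun y => fderiv ℝ f y (dirI b)) z (dirOne a)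
       + jj a * fderiv ℝ (fun y => fderiv ℝ f y (dirOne b)) z (dirI a)
       + jj a * jj b * fderiv ℝ (fun y => fderiv ℝ f y (dirI b)) z (dirI a)) := by
    intro a b
    have : DF b f = fun z => 2⁻¹ * (fderiv ℝ f z (dirOne b) + jj b * fderiv ℝ f z (dirI b)) :=
      funext fun z => DF_eq b f z
    rw [this, DF_eq, fderiv_const_mul ((hd _).fun_add ((hd _).const_mul _)),
      fderiv_fun_add (hd _) ((hd _).const_mul _), fderiv_const_mul (hd _)]
    simp
    ring
  rw [key a b, key b a, sndDeriv_symm hf z (dirOne b) (dirOne a),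
    sndDeriv_symm hf z (dirI b) (dirOne a), sndDeriv_symm hf z (dirOne b) (dirI a),
    sndDeriv_symm hf z (dirI b) (dirI a)]
  ring

/-- `d² = 0` on 2-forms. -/
lemma d_squared {η : Ix → Ix → Pt → ℂ} (hη : ∀ a b, ContDiff ℝ (⊤ : ℕ∞) (η a b))
    (a b c d : Ix) (z : Pt) :
    dThree (fun m n p w => - dTwo η m n p w) a b c d z = 0 := by
  have hd : ∀ a b c, DifferentiableAt ℝ (DF a (η b c)) z := fun a b c =>
    (DF_contDiff a (hη b c)).differentiable (by simp) z
  have e : ∀ a b c d, DF a (fun w => - dTwo η b c d w) z =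
      - (DF a (DF b (η c d)) z - DF a (DF c (η b d)) z + DF a (DF d (η b c)) z) := by
    intro a b c d
    have := DF_neg a (fun w => dTwo η b c d w) z
    rw [show (fun w => - dTwo η b c d w) = - (fun w => dTwo η b c d w) from rfl, this]
    unfold dTwo
    rw [DF_add a ((hd _ _ _).fun_sub (hd _ _ _)) (hd _ _ _), DF_sub a (hd _ _ _) (hd _ _ _)]
  unfold dThree
  rw [e, e, e, e, DF_comm b a (hη c d), DF_comm c a (hη b d), DF_comm d a (hη b c),
    DF_comm c b (hη a d), DF_comm d b (hη a c), DF_comm d c (hη a b)]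
  ring

/-! ### The hermitian form -/

lemma omF_anti (g : Fin 3 → Fin 3 → Pt → ℂ) (a b : Ix) : omF g a b = - omF g b a := by
  rcases a with a | a <;> rcases b with b | b <;> funext z <;> simp [omF]

lemma omF_smooth {g : Fin 3 → Fin 3 → Pt → ℂ} (hg : ∀ μ ν, ContDiff ℝ (⊤ : ℕ∞) (g μ ν))
    (a b : Ix) : ContDiff ℝ (⊤ : ℕ∞) (omF g a b) := by
  rcases a with a | a <;> rcases b with b | b <;> simp only [omF]
  · exact contDiff_const
  · exact contDiff_const.mul (hg _ _)
  · exact (contDiff_const.mul (hg _ _)).neg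
  · exact contDiff_const

lemma jj_sq (a : Ix) : jj a * jj a = -1 := by
  rcases a with a | a <;> simp [jj]

lemma ginvF_symm (ginv : Fin 3 → Fin 3 → Pt → ℂ) (a b : Ix) : ginvF ginv a b = ginvF ginv b a := by
  rcases a with a | a <;> rcases b with b | b <;> rfl

lemma ginvF_jj (ginv : Fin 3 → Fin 3 → Pt → ℂ) (a b : Ix) (z : Pt) :
    jj a * ginvF ginv a b z = - (jj b * ginvF ginv a b z) := by
  rcases a with a | a <;> rcases b with b | b <;> simp [jj, ginvF]

lemma hJ_of {g ginv : Fin 3 → Fin 3 → Pt → ℂ} {z : Pt}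
    (hinv1 : ∀ α β, ∑ σ, ginv α σ z * g β σ z = (if α = β then (1:ℂ) else 0))
    (hinv2 : ∀ σ τ, ∑ α, ginv α σ z * g α τ z = (if σ = τ then (1:ℂ) else 0)) (a m : Ix) :
    ∑ q, ginvF ginv q a z * omF g q m z = if a = m then jj m else 0 := by
  rw [Fintype.sum_sum_type]
  rcases a with a | a <;> rcases m with m | m
  · have := congrArg (fun x => -Complex.I * x) (hinv1 a m)
    simp only [Finset.mul_sum] at this
    simp only [ginvF, omF, jj, Sum.inl.injEq, Pi.zero_apply, zero_mul, Finset.sum_const_zero, zero_add]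
    rw [show (if a = m then -Complex.I else 0) = -Complex.I * (if a = m then 1 else 0) by simp,
      ← this]
    exact Finset.sum_congr rfl fun _ _ => by ring
  · simp [ginvF, omF]
  · simp [ginvF, omF]
  · have := congrArg (fun x => Complex.I * x) (hinv2 a m)
    simp only [Finset.mul_sum] at this
    simp only [ginvF, omF, jj, Sum.inr.injEq, Pi.zero_apply, zero_mul, Finset.sum_const_zero, add_zero]
    rw [show (if a = m then Complex.I else 0) = Complex.I * (if a = m then 1 else 0) by simp,
      ← this]
    exact Finset.sum_congr rfl fun _ _ => by ring

lemma dTwo_anti12 (g : Fin 3 → Fin 3 → Pt → ℂ) (a b c : Ix) (z : Pt) :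
    dTwo (omF g) a b c z = - dTwo (omF g) b a c z := by
  unfold dTwo
  rw [omF_anti g b a, DF_neg]; ring

lemma dTwo_anti23 (g : Fin 3 → Fin 3 → Pt → ℂ) (a b c : Ix) (z : Pt) :
    dTwo (omF g) a b c z = - dTwo (omF g) a c b z := by
  unfold dTwo
  rw [omF_anti g c b, DF_neg]; ring

lemma TorF_anti12 (g : Fin 3 → Fin 3 → Pt → ℂ) (a b c : Ix) (z : Pt) :
    TorF g a b c z = - TorF g b a c z := by
  unfold TorF
  rw [dTwo_anti12 g a b c, add_comm (nHol a) (nHol b)]; ring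

lemma TorF_anti23 (g : Fin 3 → Fin 3 → Pt → ℂ) (a b c : Ix) (z : Pt) :
    TorF g a b c z = - TorF g a c b z := by
  unfold TorF
  rw [dTwo_anti23 g a b c, add_right_comm (nHol a) (nHol b)]; ring

lemma jjj_TorF (g : Fin 3 → Fin 3 → Pt → ℂ) (a b c : Ix) (z : Pt) :
    jj a * jj b * jj c * TorF g a b c z = dTwo (omF g) a b c z := by
  unfold TorF
  rcases a with a | a <;> rcases b with b | b <;> rcases c with c | c
  · simp [dTwo, omF, DF_zero, nHol]
  all_goals first
    | (simp [dTwo, omF, DF_zero, nHol]; done)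
    | (simp only [jj, nHol]; norm_num; linear_combination (- dTwo (omF g) _ _ _ z) * Complex.I_mul_I)

lemma jj_tr_TorF (g ginv : Fin 3 → Fin 3 → Pt → ℂ) (m : Ix) (z : Pt) :
    jj m * (∑ a, ∑ b, jj a * ginvF ginv a b z * TorF g a b m z) =
      ∑ a, ∑ b, jj a * ginvF ginv a b z * dTwo (omF g) a b m z := by
  rw [Finset.mul_sum]
  refine Finset.sum_congr rfl fun a _ => ?_
  rw [Finset.mul_sum]
  refine Finset.sum_congr rfl fun b _ => ?_
  rw [← jjj_TorF g a b m z]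
  have h1 := ginvF_jj ginv a b z
  have h2 := jj_sq b
  linear_combination (-(jj b * jj m * TorF g a b m z * jj a)) * h1
    + (jj a * ginvF ginv a b z * jj m * TorF g a b m z) * h2

lemma volOm_eq (g : Fin 3 → Fin 3 → Pt → ℂ) (q r s m n p : Ix) (z : Pt) :
    volOm g ![q, r, s, m, n, p] z =
      (omF g q r z * (omF g s m z * omF g n p z - omF g s n z * omF g m p z + omF g s p z * omF g m n z)
        - omF g q s z * (omF g r m z * omF g n p z - omF g r n z * omF g m p z + omF g r p z * omF g m n z)
        + omF g q m z * (omF g r s z * omF g n p z - omF g r n z * omF g s p z + omF g r p z * omF g s n z)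
        - omF g q n z * (omF g r s z * omF g m p z - omF g r m z * omF g s p z + omF g r p z * omF g s m z)
        + omF g q p z * (omF g r s z * omF g m n z - omF g r m z * omF g s n z + omF g r n z * omF g s m z)) := by
  have h := pf6 (fun a b => omF g a b z) (fun a b => congrFun (omF_anti g a b) z)
    ![q, r, s, m, n, p]
  unfold volOm wedge222
  have e : ∀ σ : Equiv.Perm (Fin 6),
    sgn σ * omF g (![q, r, s, m, n, p] (σ 0)) (![q, r, s, m, n, p] (σ 1)) z *
      omF g (![q, r, s, m, n, p] (σ 2)) (![q, r, s, m, n, p] (σ 3)) z *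
      omF g (![q, r, s, m, n, p] (σ 4)) (![q, r, s, m, n, p] (σ 5)) z =
    sgn σ * (omF g (![q, r, s, m, n, p] (σ 0)) (![q, r, s, m, n, p] (σ 1)) z *
      omF g (![q, r, s, m, n, p] (σ 2)) (![q, r, s, m, n, p] (σ 3)) z *
      omF g (![q, r, s, m, n, p] (σ 4)) (![q, r, s, m, n, p] (σ 5)) z) := fun σ => by ring
  simp only [e]
  rw [h]
  change (6⁻¹ : ℂ) * (8⁻¹ * (48 * (omF g q r z * (omF g s m z * omF g n p z - omF g s n z * omF g m p z + omF g s p z * omF g m n z)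
        - omF g q s z * (omF g r m z * omF g n p z - omF g r n z * omF g m p z + omF g r p z * omF g m n z)
        + omF g q m z * (omF g r s z * omF g n p z - omF g r n z * omF g s p z + omF g r p z * omF g s n z)
        - omF g q n z * (omF g r s z * omF g m p z - omF g r m z * omF g s p z + omF g r p z * omF g s m z)
        + omF g q p z * (omF g r s z * omF g m n z - omF g r m z * omF g s n z + omF g r n z * omF g s m z)))) = _
  ring

/-! ### Main pointwise statement -/

lemma hstar_TorF {g ginv : Fin 3 → Fin 3 → Pt → ℂ} {E F : Pt → ℂ}
    (hg : ∀ μ ν, ContDiff ℝ (⊤ : ℕ∞) (g μ ν)) (hE : ContDiff ℝ (⊤ : ℕ∞) E)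
    (hEF : ∀ z, F z * E z = 1)
    (hinv1 : ∀ z α β, ∑ σ, ginv α σ z * g β σ z = (if α = β then (1:ℂ) else 0))
    (hinv2 : ∀ z σ τ, ∑ α, ginv α σ z * g α τ z = (if σ = τ then (1:ℂ) else 0))
    (hbal : ∀ (a b c d e : Ix) (z : Pt),
      dFour (fun a' b' c' d' w => E w * wedge22 (omF g) (omF g) a' b' c' d' w) a b c d e z = 0)
    (m n p : Ix) (z : Pt) :
    hstar g ginv (TorF g) m n p z = - F z * dTwo (fun a b w => E w * omF g a b w) m n p z := by
  have hJ := hJ_of (hinv1 z) (hinv2 z)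
  have hEd : DifferentiableAt ℝ E z := hE.differentiable (by simp) z
  have hod : ∀ a b, DifferentiableAt ℝ (omF g a b) z := fun a b =>
    (omF_smooth hg a b).differentiable (by simp) z
  have hωa : ∀ a b, omF g a b z = - omF g b a z := fun a b => congrFun (omF_anti g a b) z
  have hDa : ∀ c a b, DF c (omF g a b) z = - DF c (omF g b a) z := fun c a b => by
    rw [omF_anti g a b, DF_neg]
  have hE0 : E z ≠ 0 := right_ne_zero_of_mul (hEF z ▸ one_ne_zero)
  set θ : Ix → ℂ := fun a => - 2⁻¹ * F z * DF a E z with hθ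
  have hDE : ∀ a, DF a E z = -2 * θ a * E z := by
    intro a
    simp only [hθ]
    linear_combination (- DF a E z) * hEF z
  set W : Ix → Ix → ℂ := fun a b => jj a * ginvF ginv a b z with hWd
  have hW : ∀ a b, W a b = - W b a := fun a b => by
    simp only [hWd]; rw [ginvF_jj, ginvF_symm]
  have hWω : ∀ b c, ∑ a, W a b * omF g a c z = if b = c then 1 else 0 := by
    intro b c
    have : ∀ a, W a b * omF g a c z = - jj b * (ginvF ginv a b z * omF g a c z) := fun a => by
      simp only [hWd]; rw [ginvF_jj]; ring
    simp only [this]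
    rw [← Finset.mul_sum, hJ]
    split_ifs with h
    · subst h; linear_combination - jj_sq b
    · simp
  have h6 : Fintype.card Ix = 6 := by simp
  -- the balanced condition
  set Q : Ix → Ix → Ix → ℂ := fun a b c => dTwo (omF g) a b c z
    - (θ a * omF g b c z - θ b * omF g a c z + θ c * omF g a b z) with hQd
  have hQ12 : ∀ a b c, Q a b c = - Q b a c := fun a b c => by
    simp only [hQd]; rw [dTwo_anti12, hωa b a]; ring
  have hQ23 : ∀ a b c, Q a b c = - Q a c b := fun a b c => by
    simp only [hQd]; rw [dTwo_anti23, hωa c b]; ring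
  have hww : ∀ x a b c d, DF x (fun w => E w * wedge22 (omF g) (omF g) a b c d w) z =
      2 * E z * (-2 * θ x * (omF g a b z * omF g c d z - omF g a c z * omF g b d z
          + omF g a d z * omF g b c z)
        + (DF x (omF g a b) z * omF g c d z + omF g a b z * DF x (omF g c d) z)
        - (DF x (omF g a c) z * omF g b d z + omF g a c z * DF x (omF g b d) z)
        + (DF x (omF g a d) z * omF g b c z + omF g a d z * DF x (omF g b c) z)) := by
    intro x a b c d
    have hm : ∀ a b c d, DifferentiableAt ℝ (fun w => omF g a b w * omF g c d w) z :=
      fun a b c d => (hod a b).mul (hod c d)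
    have hP : DifferentiableAt ℝ (fun w => omF g a b w * omF g c d w - omF g a c w * omF g b d w
        + omF g a d w * omF g b c w) z := ((hm _ _ _ _).sub (hm _ _ _ _)).add (hm _ _ _ _)
    have e1 : (fun w => E w * wedge22 (omF g) (omF g) a b c d w) = fun w => (E w + E w) *
        (omF g a b w * omF g c d w - omF g a c w * omF g b d w + omF g a d w * omF g b c w) := by
      funext w; unfold wedge22; ring
    rw [e1, DF_mul x (hEd.fun_add hEd) hP, DF_add x hEd hEd,
      DF_add x ((hm _ _ _ _).fun_sub (hm _ _ _ _)) (hm _ _ _ _), DF_sub x (hm _ _ _ _) (hm _ _ _ _),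
      DF_mul x (hod _ _) (hod _ _), DF_mul x (hod _ _) (hod _ _), DF_mul x (hod _ _) (hod _ _),
      hDE]
    ring
  have hQ0 : ∀ a b c d e, omF g a b z * Q c d e - omF g a c z * Q b d e + omF g a d z * Q b c e
      - omF g a e z * Q b c d + omF g b c z * Q a d e - omF g b d z * Q a c e
      + omF g b e z * Q a c d + omF g c d z * Q a b e - omF g c e z * Q a b d
      + omF g d e z * Q a b c = 0 := by
    intro a b c d e
    have h := hbal a b c d e z
    unfold dFour at h
    rw [hww, hww, hww, hww, hww] at h
    apply mul_left_cancel₀ (mul_ne_zero two_ne_zero hE0)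
    rw [mul_zero, ← h]
    simp only [hQd, dTwo]
    ring
  have htr : ∀ e, ∑ a, ∑ b, W a b * dTwo (omF g) a b e z = 4 * θ e := by
    intro e
    have t0 := tr_zero (ω := fun a b => omF g a b z) h6 hW hWω Q hQ12 hQ23 hQ0 e
    have t1 := tr_wedge (ω := fun a b => omF g a b z) h6 hW hWω θ e
    simp only [hQd, mul_sub (W _ _) (dTwo _ _ _ _ _), Finset.sum_sub_distrib] at t0
    rw [← t1]
    exact sub_eq_zero.mp t0
  -- the star
  have hs := star_formula hJ (fun a b c => TorF g a b c z) (fun a b c => TorF_anti12 g a b c z)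
    (fun a b c => TorF_anti23 g a b c z) m n p
  unfold hstar
  simp only [volOm_eq]
  rw [hs, jjj_TorF, jj_tr_TorF, jj_tr_TorF, jj_tr_TorF, htr, htr, htr]
  have hR : dTwo (fun a b w => E w * omF g a b w) m n p z = E z * (dTwo (omF g) m n p z
      - 2 * (θ m * omF g n p z - θ n * omF g m p z + θ p * omF g m n z)) := by
    unfold dTwo
    rw [DF_mul _ hEd (hod _ _), DF_mul _ hEd (hod _ _), DF_mul _ hEd (hod _ _), hDE, hDE, hDE]
    ring
  rw [hR]
  linear_combination (dTwo (omF g) m n p z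
      - 2 * (θ m * omF g n p z - θ n * omF g m p z + θ p * omF g m n z)) * hEF z

theorem stmt13 (g ginv : Fin 3 → Fin 3 → Pt → ℂ) (Phihat : Pt → ℝ)
    -- the metric components are smooth
    (hg : ∀ μ ν, ContDiff ℝ (⊤ : ℕ∞) (g μ ν)) (hginvsm : ∀ μ ν, ContDiff ℝ (⊤ : ℕ∞) (ginv μ ν))
    -- hermitian: `conj g_{μν̄} = g_{νμ̄}`, and positive
    (hherm : ∀ μ ν z, (starRingEnd ℂ) (g μ ν z) = g ν μ z)
    (hpos : ∀ z (v : Fin 3 → ℂ), v ≠ 0 →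
      0 < (∑ μ, ∑ ν, g μ ν z * v μ * (starRingEnd ℂ) (v ν)).re)
    -- `ginv` is the inverse metric: `g^{ασ̄} g_{βσ̄} = δ^α_β` and `g^{ασ̄} g_{ατ̄} = δ^σ̄_τ̄`
    (hinv1 : ∀ z α β, ∑ σ, ginv α σ z * g β σ z = (if α = β then (1:ℂ) else 0))
    (hinv2 : ∀ z σ τ, ∑ α, ginv α σ z * g α τ z = (if σ = τ then (1:ℂ) else 0))
    -- `Φ̂` is a smooth real function
    (hPhi : ContDiff ℝ (⊤ : ℕ∞) Phihat)
    -- the conformally balanced condition `d(e^{−2Φ̂} ω²) = 0`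
    (hbal : ∀ (a b c d e : Ix) (z : Pt),
      dFour (fun a' b' c' d' w =>
        Complex.exp (-2 * (Phihat w : ℝ)) * wedge22 (omF g) (omF g) a' b' c' d' w)
        a b c d e z = 0) :
    -- conclusion 1: `⋆T = −e^{2Φ̂} d(e^{−2Φ̂} ω)`
    (∀ (m n p : Ix) (z : Pt),
      hstar g ginv (TorF g) m n p z
        = -Complex.exp (2 * (Phihat z : ℝ)) *
            dTwo (fun a b w => Complex.exp (-2 * (Phihat w : ℝ)) * omF g a b w) m n p z) ∧
    -- conclusion 2: `d ⋆ (e^{−2Φ̂} T) = 0`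
    (∀ (a b c d : Ix) (z : Pt),
      dThree (fun m n p =>
        hstar g ginv (fun i j k w =>
          Complex.exp (-2 * (Phihat w : ℝ)) * TorF g i j k w) m n p) a b c d z = 0) := by
  have hE : ContDiff ℝ (⊤ : ℕ∞) (fun w : Pt => Complex.exp (-2 * ((Phihat w : ℝ) : ℂ))) :=
    (contDiff_const.mul (Complex.ofRealCLM.contDiff.comp hPhi)).cexp
  have hEF : ∀ z : Pt, Complex.exp (2 * ((Phihat z : ℝ) : ℂ)) *
      Complex.exp (-2 * ((Phihat z : ℝ) : ℂ)) = 1 := by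
    intro z
    rw [← Complex.exp_add]
    simp
  have h1 := hstar_TorF (E := fun w : Pt => Complex.exp (-2 * ((Phihat w : ℝ) : ℂ)))
    (F := fun w : Pt => Complex.exp (2 * ((Phihat w : ℝ) : ℂ))) hg hE hEF hinv1 hinv2 hbal
  refine ⟨h1, fun a b c d z => ?_⟩
  have h2 : (fun m n p => hstar g ginv (fun i j k w =>
      Complex.exp (-2 * (Phihat w : ℝ)) * TorF g i j k w) m n p) =
      fun m n p w => - dTwo (fun a b w => Complex.exp (-2 * (Phihat w : ℝ)) * omF g a b w)
        m n p w := by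
    funext m n p w
    have e : hstar g ginv (fun i j k w =>
        Complex.exp (-2 * (Phihat w : ℝ)) * TorF g i j k w) m n p w =
        Complex.exp (-2 * (Phihat w : ℝ)) * hstar g ginv (TorF g) m n p w := by
      unfold hstar
      simp only [Finset.mul_sum]
      refine Finset.sum_congr rfl fun q _ => Finset.sum_congr rfl fun r _ =>
        Finset.sum_congr rfl fun s _ => Finset.sum_congr rfl fun q' _ =>
        Finset.sum_congr rfl fun r' _ => Finset.sum_congr rfl fun s' _ => ?_
      ring
    rw [e, h1 m n p w]
    linear_combination (- dTwo (fun a b w => Complex.exp (-2 * (Phihat w : ℝ)) * omF g a b w)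
        m n p w) * hEF w
  rw [h2]
  exact d_squared (fun a b => hE.mul (omF_smooth hg a b)) a b c d z
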